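/- arXiv:0911.1272 — 2 statements merged into one kernel-verified Lean document; each statement's English description precedes it below -/
import Mathlib

section
/- For any ring R, the class ^⊥GI(R) is projectively resolving: it contains all projective R-modules, and for every short exact sequence 0 → X' → X → X'' → 0 of R-modules with X'' ∈ ^⊥GI(R), one has X' ∈ ^⊥GI(R) if and only if X ∈ ^⊥GI(R). -/
universe u

open CategoryTheory

/-- `extVanish R n M N` asserts that `Ext_R^n(M, N) = 0`. -/
def extVanish (R : Type u) [Ring R] (n : ℕ) (M N : ModuleCat.{u} R) : Prop :=
  letI := HasDerivedCategory.standard (ModuleCat.{u} R)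
  letI : HasExt.{u + 1} (ModuleCat.{u} R) := hasExt_of_hasDerivedCategory _
  Subsingleton (Abelian.Ext M N n)

/-- A module `G` is Gorenstein projective if there is an exact sequence of projective
modules `⋯ → P i → P (i+1) → ⋯` with `G ≅ Im (d 0)` which stays exact after applying
`Hom_R(−, Q)` for every projective module `Q`. -/
def IsGorensteinProjective (R : Type u) [Ring R] (G : ModuleCat.{u} R) : Prop :=
  ∃ (P : ℤ → ModuleCat.{u} R) (d : ∀ i : ℤ, P i →ₗ[R] P (i + 1)),
    (∀ i, Module.Projective R (P i)) ∧
    (∀ i, LinearMap.range (d i) = LinearMap.ker (d (i + 1))) ∧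
    Nonempty (G ≃ₗ[R] LinearMap.range (d 0)) ∧
    ∀ (Q : ModuleCat.{u} R), Module.Projective R Q →
      ∀ (i : ℤ) (f : P (i + 1) →ₗ[R] Q), f ∘ₗ d i = 0 →
        ∃ g : P (i + 1 + 1) →ₗ[R] Q, g ∘ₗ d (i + 1) = f

/-- A module `G` is Gorenstein injective if there is an exact sequence of injective
modules `⋯ → I i → I (i+1) → ⋯` with `G ≅ Im (d 0)` which stays exact after applying
`Hom_R(E, −)` for every injective module `E`. -/
def IsGorensteinInjective (R : Type u) [Ring R] (G : ModuleCat.{u} R) : Prop :=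
  ∃ (I : ℤ → ModuleCat.{u} R) (d : ∀ i : ℤ, I i →ₗ[R] I (i + 1)),
    (∀ i, Module.Injective R (I i)) ∧
    (∀ i, LinearMap.range (d i) = LinearMap.ker (d (i + 1))) ∧
    Nonempty (G ≃ₗ[R] LinearMap.range (d 0)) ∧
    ∀ (E : ModuleCat.{u} R), Module.Injective R E →
      ∀ (i : ℤ) (f : E →ₗ[R] I (i + 1)), d (i + 1) ∘ₗ f = 0 →
        ∃ g : E →ₗ[R] I i, d i ∘ₗ g = f

/-- A linear short exact sequence of modules is short exact in `ModuleCat`. -/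
lemma shortExact_of_range_eq_ker {R : Type u} [Ring R] {X₁ X₂ X₃ : ModuleCat.{u} R}
    (f : X₁ →ₗ[R] X₂) (g : X₂ →ₗ[R] X₃) (hf : Function.Injective f)
    (hg : Function.Surjective g) (hfg : LinearMap.range f = LinearMap.ker g) :
    (ShortComplex.moduleCatMk f g (LinearMap.range_le_ker_iff.1 hfg.le)).ShortExact where
  exact := (ShortComplex.moduleCat_exact_iff_range_eq_ker _).2 hfg
  mono_f := (ModuleCat.mono_iff_injective _).2 hf
  epi_g := (ModuleCat.epi_iff_surjective _).2 hg

/-- Every Gorenstein injective module is the kernel of an epimorphism from an injective module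
to a Gorenstein injective module. -/
lemma IsGorensteinInjective.exists_shortExact {R : Type u} [Ring R] {G : ModuleCat.{u} R}
    (hG : IsGorensteinInjective R G) :
    ∃ S : ShortComplex (ModuleCat.{u} R), S.ShortExact ∧ S.X₁ = G ∧ Injective S.X₂ ∧
      IsGorensteinInjective R S.X₃ := by
  obtain ⟨I, d, hI, hd, ⟨e⟩, hE⟩ := hG
  let ι : G →ₗ[R] I (0 + 1) := (LinearMap.range (d 0)).subtype ∘ₗ e.toLinearMap
  have hι : LinearMap.range ι = LinearMap.ker (d (0 + 1)).rangeRestrict := by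
    rw [LinearMap.ker_rangeRestrict, ← hd, LinearMap.range_comp_of_range_eq_top _ e.range,
      Submodule.range_subtype]
  exact ⟨_, shortExact_of_range_eq_ker (X₃ := ModuleCat.of R (LinearMap.range (d (0 + 1)))) ι
      (d (0 + 1)).rangeRestrict (Subtype.val_injective.comp e.injective)
      (d (0 + 1)).surjective_rangeRestrict hι, rfl,
    Module.injective_object_of_injective_module (inj := hI (0 + 1)),
    fun i => I (i + 1), fun i => d (i + 1), fun i => hI (i + 1), fun i => hd (i + 1),
    ⟨LinearEquiv.refl R _⟩, fun E hE' i => hE E hE' (i + 1)⟩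

namespace CategoryTheory.ShortComplex.ShortExact

open Abelian

universe w v' u'

variable {C : Type u'} [Category.{v'} C] [Abelian C] [HasExt.{w} C] {S : ShortComplex C}

/-- Dimension shifting along a short exact sequence with injective middle term. -/
lemma subsingleton_ext_succ_X₁ (hS : S.ShortExact) [Injective S.X₂] (X : C) (n : ℕ)
    (_ : Subsingleton (Ext X S.X₃ n)) : Subsingleton (Ext X S.X₁ (n + 1)) := by
  have := Ext.subsingleton_of_injective X S.X₂ n
  refine subsingleton_of_forall_eq 0 fun x => ?_
  obtain ⟨y, rfl⟩ := Ext.covariant_sequence_exact₁ X hS x (Subsingleton.elim _ _) rfl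
  rw [Subsingleton.elim y 0, Ext.zero_comp]

lemma subsingleton_ext_X₂ (hS : S.ShortExact) (Y : C) (n : ℕ)
    (_ : Subsingleton (Ext S.X₁ Y n)) (_ : Subsingleton (Ext S.X₃ Y n)) :
    Subsingleton (Ext S.X₂ Y n) := by
  refine subsingleton_of_forall_eq 0 fun x => ?_
  obtain ⟨y, rfl⟩ := Ext.contravariant_sequence_exact₂ hS Y x (Subsingleton.elim _ _)
  rw [Subsingleton.elim y 0, Ext.comp_zero]

lemma subsingleton_ext_X₁ (hS : S.ShortExact) (Y : C) (n : ℕ)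
    (_ : Subsingleton (Ext S.X₂ Y n)) (_ : Subsingleton (Ext S.X₃ Y (n + 1))) :
    Subsingleton (Ext S.X₁ Y n) := by
  refine subsingleton_of_forall_eq 0 fun x => ?_
  obtain ⟨y, rfl⟩ :=
    Ext.contravariant_sequence_exact₁ hS Y x (Nat.add_comm 1 n) (Subsingleton.elim _ _)
  rw [Subsingleton.elim y 0, Ext.comp_zero]

end CategoryTheory.ShortComplex.ShortExact

/-- For any ring `R`, the class `^⊥GI(R)` is projectively resolving: it contains all
projective modules, and in every short exact sequence `0 → X₁ → X₂ → X₃ → 0` with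
`X₃ ∈ ^⊥GI(R)`, we have `X₁ ∈ ^⊥GI(R) ↔ X₂ ∈ ^⊥GI(R)`. -/
theorem giLeftPerp_projectively_resolving (R : Type u) [Ring R] :
    (∀ P : ModuleCat.{u} R, Module.Projective R P →
      ∀ G, IsGorensteinInjective R G → extVanish R 1 P G) ∧
    (∀ (X₁ X₂ X₃ : ModuleCat.{u} R) (f : X₁ →ₗ[R] X₂) (g : X₂ →ₗ[R] X₃),
      Function.Injective f → Function.Surjective g →
      LinearMap.range f = LinearMap.ker g →
      (∀ G, IsGorensteinInjective R G → extVanish R 1 X₃ G) →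
      ((∀ G, IsGorensteinInjective R G → extVanish R 1 X₁ G) ↔
        (∀ G, IsGorensteinInjective R G → extVanish R 1 X₂ G))) := by
  let := HasDerivedCategory.standard (ModuleCat.{u} R)
  let : HasExt.{u + 1} (ModuleCat.{u} R) := hasExt_of_hasDerivedCategory _
  refine ⟨fun P hP G _ => ?_, fun X₁ X₂ X₃ f g hf hg hfg h₃ => ?_⟩
  · have : Projective P := (IsProjective.iff_projective P).1 hP
    exact Abelian.Ext.subsingleton_of_projective P G 0
  have hS := shortExact_of_range_eq_ker f g hf hg hfg
  refine ⟨fun h₁ G hG => hS.subsingleton_ext_X₂ G 1 (h₁ G hG) (h₃ G hG), fun h₂ G hG => ?_⟩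
  obtain ⟨T, hT, rfl, _, hT₃⟩ := hG.exists_shortExact
  exact hS.subsingleton_ext_X₁ T.X₁ 1 (h₂ T.X₁ hG)
    (hT.subsingleton_ext_succ_X₁ X₃ 1 (h₃ T.X₃ hT₃))
end

section
/- For any ring R, an R-module is injective if and only if it is both Gorenstein injective and belongs to ^⊥GI(R); that is, I(R) = GI(R) ∩ ^⊥GI(R). -/
universe u

open CategoryTheory

/-- A short exact sequence `0 → X → Y → Z → 0` with `Y` injective computes `Ext¹(M, X)` as the
obstruction to lifting maps `M → Z` along `Y → Z`. -/
lemma extVanish_one_iff_forall_exists_lift {R : Type u} [Ring R] (M : ModuleCat.{u} R)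
    {X Y Z : Type u} [AddCommGroup X] [Module R X] [AddCommGroup Y] [Module R Y]
    [AddCommGroup Z] [Module R Z] [Module.Injective R Y] (f : X →ₗ[R] Y) (g : Y →ₗ[R] Z)
    (hf : Function.Injective f) (hfg : Function.Exact f g) (hg : Function.Surjective g) :
    extVanish R 1 M (ModuleCat.of R X) ↔ ∀ h : M →ₗ[R] Z, ∃ k : M →ₗ[R] Y, g ∘ₗ k = h := by
  let := HasDerivedCategory.standard (ModuleCat.{u} R)
  let : HasExt.{u + 1} (ModuleCat.{u} R) := hasExt_of_hasDerivedCategory _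
  let S : ShortComplex (ModuleCat.{u} R) := ShortComplex.moduleCatMk f g hfg.linearMap_comp_eq_zero
  have hS : S.ShortExact := ModuleCat.shortComplex_shortExact S hfg hf hg
  have : Injective S.X₂ := Module.injective_object_of_injective_module R Y
  change Subsingleton (Abelian.Ext M S.X₁ 1) ↔ _
  constructor
  · intro _ h
    obtain ⟨x, hx⟩ := Abelian.Ext.covariant_sequence_exact₃ M hS
      (Abelian.Ext.mk₀ (ModuleCat.ofHom h)) (zero_add 1) (Subsingleton.elim _ _)
    obtain ⟨k, rfl⟩ := (Abelian.Ext.mk₀_bijective _ _).2 x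
    rw [Abelian.Ext.mk₀_comp_mk₀] at hx
    have hk := (Abelian.Ext.mk₀_bijective _ _).1 hx
    exact ⟨k.hom, congrArg ModuleCat.Hom.hom hk⟩
  · intro H
    refine subsingleton_of_forall_eq 0 fun x ↦ ?_
    obtain ⟨y, rfl⟩ := Abelian.Ext.covariant_sequence_exact₁ M hS x
      (Abelian.Ext.eq_zero_of_injective _) (zero_add 1)
    obtain ⟨h, rfl⟩ := (Abelian.Ext.mk₀_bijective _ _).2 y
    obtain ⟨k, hk⟩ := H h.hom
    let k' : M ⟶ S.X₂ := ModuleCat.ofHom k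
    have hk' : h = k' ≫ S.g := ModuleCat.hom_ext hk.symm
    rw [hk', ← Abelian.Ext.mk₀_comp_mk₀, Abelian.Ext.comp_assoc_of_second_deg_zero,
      hS.comp_extClass, Abelian.Ext.comp_zero]

/-- An injective module is Gorenstein injective, via the complex `⋯ → M → M → ⋯` whose maps are
alternately the identity and zero. -/
lemma IsGorensteinInjective.of_injective {R : Type u} [Ring R] (M : ModuleCat.{u} R)
    [Module.Injective R M] : IsGorensteinInjective R M := by
  classical
  refine ⟨fun _ ↦ M, fun i ↦ if Even i then LinearMap.id else 0, fun _ ↦ inferInstance,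
    fun i ↦ ?_, ?_, fun E _ i f hf ↦ ?_⟩
  · simp only [Int.even_add_one]
    by_cases hi : Even i <;> simp [hi, -Int.not_even_iff_odd]
  · exact ⟨(LinearEquiv.ofTop _ (by simp)).symm⟩
  · simp only [Int.even_add_one] at hf
    by_cases hi : Even i
    · exact ⟨f, by simp [hi]⟩
    · refine ⟨0, ?_⟩
      simpa [hi, -Int.not_even_iff_odd, eq_comm] using hf

/-- If `M` is injective and `G` is Gorenstein injective, then `Ext¹(M, G) = 0`. -/
lemma IsGorensteinInjective.extVanish_one {R : Type u} [Ring R] {M G : ModuleCat.{u} R}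
    [Module.Injective R M] (hG : IsGorensteinInjective R G) : extVanish R 1 M G := by
  obtain ⟨I, d, hI, hd, ⟨e⟩, hlift⟩ := hG
  have := hI (0 + 1)
  refine (extVanish_one_iff_forall_exists_lift M ((LinearMap.range (d 0)).subtype ∘ₗ e.toLinearMap)
    (d (0 + 1)).rangeRestrict (Subtype.val_injective.comp e.injective) ?_
    (d (0 + 1)).surjective_rangeRestrict).2 fun h ↦ ?_
  · rw [LinearMap.exact_iff, LinearMap.ker_rangeRestrict, ← hd 0, LinearMap.range_comp]
    simp
  · obtain ⟨k, hk⟩ := hlift M ‹_› (0 + 1) ((LinearMap.range (d (0 + 1))).subtype ∘ₗ h) (by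
      ext x
      have : (h x : I (0 + 1 + 1)) ∈ LinearMap.ker (d (0 + 1 + 1)) := hd (0 + 1) ▸ (h x).2
      exact this)
    exact ⟨k, LinearMap.ext fun x ↦ Subtype.ext (LinearMap.congr_fun hk x)⟩

/-- The kernel of a differential in a complex witnessing Gorenstein injectivity is again
Gorenstein injective: shift the complex by one. -/
lemma IsGorensteinInjective.of_ker {R : Type u} [Ring R] (I : ℤ → ModuleCat.{u} R)
    (d : ∀ i : ℤ, I i →ₗ[R] I (i + 1)) (hI : ∀ i, Module.Injective R (I i))
    (hd : ∀ i, LinearMap.range (d i) = LinearMap.ker (d (i + 1)))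
    (hlift : ∀ (E : ModuleCat.{u} R), Module.Injective R E →
      ∀ (i : ℤ) (f : E →ₗ[R] I (i + 1)), d (i + 1) ∘ₗ f = 0 → ∃ g : E →ₗ[R] I i, d i ∘ₗ g = f) :
    IsGorensteinInjective R (ModuleCat.of R (LinearMap.ker (d 0))) := by
  let D : ∀ i j : ℤ, i + 1 = j → (I i →ₗ[R] I j) := fun i _ h ↦ h ▸ d i
  have hD : ∀ i j k (hij : i + 1 = j) (hjk : j + 1 = k),
      LinearMap.range (D i j hij) = LinearMap.ker (D j k hjk) := by
    rintro i _ _ rfl rfl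
    exact hd i
  have hD_lift : ∀ (E : ModuleCat.{u} R), Module.Injective R E →
      ∀ i j k (hij : i + 1 = j) (hjk : j + 1 = k) (f : E →ₗ[R] I j), D j k hjk ∘ₗ f = 0 →
        ∃ g : E →ₗ[R] I i, D i j hij ∘ₗ g = f := by
    rintro E hE i _ _ rfl rfl
    exact hlift E hE i
  refine ⟨fun i ↦ I (i - 1), fun i ↦ D (i - 1) (i + 1 - 1) (by lia), fun i ↦ hI _,
    fun i ↦ hD _ _ _ _ _, ?_, fun E hE i ↦ hD_lift E hE _ _ _ _ _⟩
  exact ⟨LinearEquiv.ofEq _ _ (hD (0 - 1) 0 (0 + 1) (by lia) rfl).symm⟩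

/-- A linear retract of an injective module is injective. -/
lemma Module.Injective.of_leftInverse {R : Type u} [Ring R] {M N : Type u} [AddCommGroup M]
    [Module R M] [AddCommGroup N] [Module R N] [Module.Injective R N] (s : M →ₗ[R] N)
    (p : N →ₗ[R] M) (h : p ∘ₗ s = LinearMap.id) : Module.Injective R M where
  out X Y _ _ _ _ f hf g := by
    obtain ⟨k, hk⟩ := Module.Injective.out (Q := N) f hf (s ∘ₗ g)
    exact ⟨p ∘ₗ k, fun x ↦ by simpa [hk] using LinearMap.congr_fun h (g x)⟩

/-- For any ring `R`, `I(R) = GI(R) ∩ ^⊥GI(R)`. -/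
theorem injective_iff_gorensteinInjective_and_mem_leftPerp (R : Type u) [Ring R]
    (M : ModuleCat.{u} R) :
    Module.Injective R M ↔
      (IsGorensteinInjective R M ∧
        ∀ G, IsGorensteinInjective R G → extVanish R 1 M G) := by
  refine ⟨fun _ ↦ ⟨.of_injective M, fun _ hG ↦ hG.extVanish_one⟩, ?_⟩
  rintro ⟨⟨I, d, hI, hd, ⟨e⟩, hlift⟩, hM⟩
  have := hI 0
  obtain ⟨s, hs⟩ := (extVanish_one_iff_forall_exists_lift M (LinearMap.ker (d 0)).subtype
    (d 0).rangeRestrict Subtype.val_injective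
    (by rw [LinearMap.exact_iff, LinearMap.ker_rangeRestrict, Submodule.range_subtype])
    (d 0).surjective_rangeRestrict).1 (hM _ (.of_ker I d hI hd hlift)) e.toLinearMap
  refine Module.Injective.of_leftInverse s (e.symm.toLinearMap ∘ₗ (d 0).rangeRestrict) ?_
  rw [LinearMap.comp_assoc, hs]
  ext x
  simp
end
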